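/- (Minimax identity for the strong converse exponent.) For every real number R: inf over probability vectors P on {1,…,n} of sup over s ∈ (−1,0) of (s·I^{(1),*}_{1/(1+s)}(P,W) − s·R) equals sup over s ∈ (−1,0) of inf over probability vectors P on {1,…,n} of (s·I^{(1),*}_{1/(1+s)}(P,W) − s·R). -/

import Mathlib

open Matrix
open scoped ComplexOrder

/-- Real power of a (hermitian) matrix via the continuous functional calculus. -/
noncomputable def mpow {ι : Type*} [Fintype ι] [DecidableEq ι]
    (A : Matrix ι ι ℂ) (r : ℝ) : Matrix ι ι ℂ :=
  cfc (fun x : ℝ => x ^ r) A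

/-- Logarithm of a (hermitian) matrix via the continuous functional calculus. -/
noncomputable def mlog {ι : Type*} [Fintype ι] [DecidableEq ι]
    (A : Matrix ι ι ℂ) : Matrix ι ι ℂ :=
  cfc Real.log A

/-- Real part of the trace. -/
noncomputable def trR {ι : Type*} [Fintype ι] (A : Matrix ι ι ℂ) : ℝ :=
  (Matrix.trace A).re

/-- Positive definite density matrices. -/
def Dens (d : ℕ) : Type :=
  {σ : Matrix (Fin d) (Fin d) ℂ // σ.PosDef ∧ σ.trace = 1}

/-- Sandwiched Rényi information of order `α ≠ 1`. -/
noncomputable def sandwichedRenyiInfo {d n : ℕ} (α : ℝ)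
    (W : Fin n → Matrix (Fin d) (Fin d) ℂ) (P : Fin n → ℝ) : ℝ :=
  ⨅ σ : Dens d, (1 / (α - 1)) * Real.log (∑ i, P i *
    trR (mpow (mpow σ.1 ((1 - α) / (2 * α)) * W i * mpow σ.1 ((1 - α) / (2 * α))) α))

/-- Hölder's inequality in the form `∑ uᵃ vᵇ ≤ (∑ u)ᵃ (∑ v)ᵇ` for `a + b = 1`. -/
theorem sum_rpow_mul_rpow_le {ι : Type*} (t : Finset ι) {u v : ι → ℝ} {a b : ℝ}
    (hu : ∀ i ∈ t, 0 ≤ u i) (hv : ∀ i ∈ t, 0 ≤ v i) (ha : 0 < a) (hb : 0 < b) (hab : a + b = 1) :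
    ∑ i ∈ t, u i ^ a * v i ^ b ≤ (∑ i ∈ t, u i) ^ a * (∑ i ∈ t, v i) ^ b := by
  have hpq : (a⁻¹).HolderConjugate b⁻¹ := by
    rw [Real.holderConjugate_iff]
    refine ⟨(one_lt_inv₀ ha).2 (by linarith), by simpa using hab⟩
  have h := Real.inner_le_Lp_mul_Lq_of_nonneg t hpq
    (fun i hi => Real.rpow_nonneg (hu i hi) a) (fun i hi => Real.rpow_nonneg (hv i hi) b)
  rw [Finset.sum_congr rfl fun i hi => Real.rpow_rpow_inv (hu i hi) ha.ne',
    Finset.sum_congr rfl fun i hi => Real.rpow_rpow_inv (hv i hi) hb.ne'] at h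
  simpa using h

/-- If the maximum of two convex functions exceeds `c` on a compact convex set, then so does
some convex combination of them. -/
theorem exists_convexComb_gt {E : Type*} [NormedAddCommGroup E] [NormedSpace ℝ E] {K : Set E}
    (hK : IsCompact K) (hKc : Convex ℝ K) {f g : E → ℝ} (hf : ConvexOn ℝ K f)
    (hg : ConvexOn ℝ K g) (hfc : ContinuousOn f K) (hgc : ContinuousOn g K) {c : ℝ}
    (h : ∀ x ∈ K, c < f x ∨ c < g x) :
    ∃ θ ∈ Set.Icc (0 : ℝ) 1, ∀ x ∈ K, c < (1 - θ) * f x + θ * g x := by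
  rcases K.eq_empty_or_nonempty with rfl | hne
  · exact ⟨0, by simp, by simp⟩
  obtain ⟨a, ha, b, hb, hab⟩ := Sion.exists_isSaddlePointOn
    (f := fun x θ => (1 - θ) * f x + θ * g x) hne hKc hK
    (fun y _ => ((hfc.const_smul (1 - y)).add (hgc.const_smul y)).lowerSemicontinuousOn)
    (fun y (hy : y ∈ Set.Icc (0 : ℝ) 1) =>
      ((hf.smul (sub_nonneg.2 hy.2)).add (hg.smul hy.1)).quasiconvexOn)
    (convex_Icc 0 1)
    ⟨0, by simp⟩ isCompact_Icc
    (fun x _ => (by fun_prop : Continuous fun θ : ℝ =>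
      (1 - θ) * f x + θ * g x).continuousOn.upperSemicontinuousOn)
    (fun x _ => (ConcaveOn.quasiconcaveOn ⟨convex_Icc 0 1, fun y _ z _ p q _ _ hpq => by
      obtain rfl : p = 1 - q := eq_sub_of_add_eq hpq
      simp only [smul_eq_mul]
      exact le_of_eq (by ring)⟩))
  refine ⟨b, hb, fun x hx => ?_⟩
  rcases h a ha with hl | hl
  · exact hl.trans_le (by simpa using hab x hx 0 (by simp))
  · exact hl.trans_le (by simpa using hab x hx 1 (by simp))

/-- Fan's minimax theorem for a family of continuous convex functions on a compact convex set
that is concave-like in the parameter. -/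
theorem exists_forall_gt_of_concaveLike {E J : Type*} [NormedAddCommGroup E] [NormedSpace ℝ E]
    [Nonempty J] {K : Set E} (hK : IsCompact K) (hKc : Convex ℝ K) {G : J → E → ℝ}
    (hG : ∀ j, ConvexOn ℝ K (G j)) (hGc : ∀ j, ContinuousOn (G j) K)
    (hJ : ∀ j₀ j₁, ∀ θ ∈ Set.Ioo (0 : ℝ) 1, ∃ j, ∀ x ∈ K,
      (1 - θ) * G j₀ x + θ * G j₁ x ≤ G j x)
    {c : ℝ} (h : ∀ x ∈ K, ∃ j, c < G j x) : ∃ j, ∀ x ∈ K, c < G j x := by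
  classical
  have key : ∀ (T : Finset J) (K' : Set E), K' ⊆ K → IsCompact K' → Convex ℝ K' →
      (∀ x ∈ K', ∃ j ∈ T, c < G j x) → ∃ j, ∀ x ∈ K', c < G j x := by
    intro T
    induction T using Finset.induction_on with
    | empty =>
      intro K' _ _ _ hc
      exact ⟨Classical.arbitrary J, fun x hx => by simpa using hc x hx⟩
    | insert j T _ ih =>
      intro K' hsub hcpt hconv hc
      have hcl : IsCompact {x ∈ K' | G j x ≤ c} :=
        hcpt.of_isClosed_subset
          (((hGc j).mono hsub).preimage_isClosed_of_isClosed hcpt.isClosed isClosed_Iic)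
          (Set.sep_subset _ _)
      obtain ⟨j', hj'⟩ := ih _ ((Set.sep_subset _ _).trans hsub) hcl
        (((hG j).subset hsub hconv).convex_le c) (fun x hx => by
          obtain ⟨i, hi, hlt⟩ := hc x hx.1
          rcases Finset.mem_insert.1 hi with rfl | hi
          · exact absurd hx.2 hlt.not_ge
          · exact ⟨i, hi, hlt⟩)
      obtain ⟨θ, hθ, hlt⟩ := exists_convexComb_gt hcpt hconv ((hG j).subset hsub hconv)
        ((hG j').subset hsub hconv) ((hGc j).mono hsub) ((hGc j').mono hsub) (c := c)
        (fun x hx => by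
          rcases lt_or_ge c (G j x) with h1 | h1
          · exact Or.inl h1
          · exact Or.inr (hj' x ⟨hx, h1⟩))
      rcases hθ.1.eq_or_lt with rfl | h0
      · exact ⟨j, by simpa using hlt⟩
      rcases hθ.2.eq_or_lt with rfl | h1
      · exact ⟨j', by simpa using hlt⟩
      obtain ⟨i, hi⟩ := hJ j j' θ ⟨h0, h1⟩
      exact ⟨i, fun x hx => (hlt x hx).trans_le (hi x (hsub hx))⟩
  obtain ⟨T, hT⟩ := (LowerSemicontinuousOn.inter_biInter_preimage_Iic_eq_empty_iff_exists_finset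
    (I := Set.univ) (c := c) hK (fun j _ => (hGc j).lowerSemicontinuousOn)).1 (by
      refine Set.eq_empty_of_forall_notMem fun x hx => ?_
      obtain ⟨j, hj⟩ := h x hx.1
      exact hj.not_ge (by simpa using Set.mem_iInter₂.1 hx.2 j (Set.mem_univ j)))
  refine key (T.image Subtype.val) K subset_rfl hK hKc fun x hx => ?_
  obtain ⟨j, hj, hlt⟩ := hT x hx
  exact ⟨j, Finset.mem_image_of_mem _ hj, hlt⟩

theorem trR_smul {ι : Type*} [Fintype ι] (c : ℝ) (A : Matrix ι ι ℂ) :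
    trR (c • A) = c * trR A := by
  simp [trR]

section Matrices

variable {ι : Type*} [Fintype ι] [DecidableEq ι]

theorem trR_mpow {A : Matrix ι ι ℂ} (hA : A.IsHermitian) (p : ℝ) :
    trR (mpow A p) = ∑ i, hA.eigenvalues i ^ p := by
  rw [trR, mpow, hA.cfc_eq, IsHermitian.cfc, Unitary.conjStarAlgAut_apply, trace_mul_cycle,
    Unitary.coe_star_mul_self, one_mul, trace_diagonal, Complex.re_sum]
  simp

theorem trR_mpow_congr {A B : Matrix ι ι ℂ} (hA : A.IsHermitian) (hB : B.IsHermitian)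
    (h : A.charpoly = B.charpoly) (p : ℝ) : trR (mpow A p) = trR (mpow B p) := by
  rw [trR_mpow hA, trR_mpow hB, (hA.eigenvalues_eq_eigenvalues_iff hB).2 h]

theorem mul_diagonal_mul_conjTranspose_apply_self (X : Matrix ι ι ℂ) (d : ι → ℝ) (l : ι) :
    (X * diagonal (fun k => (d k : ℂ)) * Xᴴ) l l = ((∑ k, d k * ‖X l k‖ ^ 2 : ℝ) : ℂ) := by
  rw [mul_apply]
  push_cast
  refine Finset.sum_congr rfl fun k _ => ?_
  rw [mul_diagonal, conjTranspose_apply, mul_right_comm, Complex.star_def, Complex.mul_conj']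
  ring

theorem sum_norm_sq_row (U : unitaryGroup ι ℂ) (l : ι) :
    ∑ k, ‖(U : Matrix ι ι ℂ) l k‖ ^ 2 = 1 := by
  have h := mul_diagonal_mul_conjTranspose_apply_self (U : Matrix ι ι ℂ) (fun _ => 1) l
  have hU : (U : Matrix ι ι ℂ) * (U : Matrix ι ι ℂ)ᴴ = 1 := Unitary.coe_mul_star_self U
  simp only [Complex.ofReal_one, diagonal_one, mul_one, one_mul, hU, one_apply_eq] at h
  exact_mod_cast h.symm

theorem sum_norm_sq_col (U : unitaryGroup ι ℂ) (k : ι) :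
    ∑ l, ‖(U : Matrix ι ι ℂ) l k‖ ^ 2 = 1 := by
  simpa [star_eq_conjTranspose, conjTranspose_apply] using sum_norm_sq_row (star U) k

/-- The spectral theorem as a product of three matrices. -/
theorem Matrix.IsHermitian.eq_mul_diagonal_mul {A : Matrix ι ι ℂ} (hA : A.IsHermitian) :
    A = (hA.eigenvectorUnitary : Matrix ι ι ℂ) * diagonal (fun k => (hA.eigenvalues k : ℂ)) *
      (hA.eigenvectorUnitary : Matrix ι ι ℂ)ᴴ := by
  conv_lhs => rw [hA.spectral_theorem, Unitary.conjStarAlgAut_apply]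
  rfl

/-- Peierls' inequality for `x ↦ x ^ p`. -/
theorem sum_diag_rpow_le_trR_mpow {B : Matrix ι ι ℂ} (hB : B.PosSemidef)
    (V : unitaryGroup ι ℂ) {p : ℝ} (hp : 1 ≤ p) :
    ∑ l, (((V : Matrix ι ι ℂ)ᴴ * B * (V : Matrix ι ι ℂ)) l l).re ^ p ≤ trR (mpow B p) := by
  have hH := hB.isHermitian
  set X : unitaryGroup ι ℂ := star V * hH.eigenvectorUnitary with hX
  have hXB : (V : Matrix ι ι ℂ)ᴴ * B * (V : Matrix ι ι ℂ) = (X : Matrix ι ι ℂ) *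
      diagonal (fun k => (hH.eigenvalues k : ℂ)) * (X : Matrix ι ι ℂ)ᴴ := by
    conv_lhs => rw [hH.eq_mul_diagonal_mul]
    simp [hX, star_eq_conjTranspose, conjTranspose_mul, mul_assoc]
  rw [trR_mpow hH]
  calc ∑ l, (((V : Matrix ι ι ℂ)ᴴ * B * (V : Matrix ι ι ℂ)) l l).re ^ p
      = ∑ l, (∑ k, ‖(X : Matrix ι ι ℂ) l k‖ ^ 2 * hH.eigenvalues k) ^ p := by
        refine Finset.sum_congr rfl fun l _ => ?_
        rw [hXB, mul_diagonal_mul_conjTranspose_apply_self, Complex.ofReal_re]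
        simp_rw [mul_comm]
    _ ≤ ∑ l, ∑ k, ‖(X : Matrix ι ι ℂ) l k‖ ^ 2 * hH.eigenvalues k ^ p :=
        Finset.sum_le_sum fun l _ => Real.rpow_arith_mean_le_arith_mean_rpow _ _ _
          (fun _ _ => by positivity) (sum_norm_sq_row X l)
          (fun k _ => hB.eigenvalues_nonneg k) hp
    _ = ∑ k, hH.eigenvalues k ^ p := by
        rw [Finset.sum_comm]
        refine Finset.sum_congr rfl fun k _ => ?_
        rw [← Finset.sum_mul, sum_norm_sq_col, one_mul]

theorem trR_mpow_nonneg {A : Matrix ι ι ℂ} (hA : A.PosSemidef) (p : ℝ) :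
    0 ≤ trR (mpow A p) := by
  rw [trR_mpow hA.isHermitian]
  exact Finset.sum_nonneg fun i _ => Real.rpow_nonneg (hA.eigenvalues_nonneg i) p

theorem posSemidef_mul_diagonal_mul (S : Matrix ι ι ℂ) {d : ι → ℝ} (hd : ∀ k, 0 ≤ d k) :
    (S * diagonal (fun k => (d k : ℂ)) * Sᴴ).PosSemidef :=
  (PosSemidef.diagonal fun k => by simpa using hd k).mul_mul_conjTranspose_same S

/-- Hölder's inequality for the Schatten norms of the weighted geometric mean
`S D ^ θ Sᴴ` of `S Sᴴ` and `S D Sᴴ`. -/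
theorem trR_mpow_geomMean_le (S : Matrix ι ι ℂ) {d : ι → ℝ} (hd : ∀ k, 0 ≤ d k)
    {θ q₀ q₁ q : ℝ} (hθ : θ ∈ Set.Ioo (0 : ℝ) 1) (hq₀ : q₀ ∈ Set.Ioc (0 : ℝ) 1)
    (hq₁ : q₁ ∈ Set.Ioc (0 : ℝ) 1) (hq : q = (1 - θ) * q₀ + θ * q₁) :
    trR (mpow (S * diagonal (fun k => ((d k ^ θ : ℝ) : ℂ)) * Sᴴ) (1 / q)) ≤
      trR (mpow (S * Sᴴ) (1 / q₀)) ^ ((1 - θ) * q₀ / q) *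
        trR (mpow (S * diagonal (fun k => (d k : ℂ)) * Sᴴ) (1 / q₁)) ^ (θ * q₁ / q) := by
  have hθ' : 0 < 1 - θ := sub_pos.2 hθ.2
  have hq0 : 0 < q := hq ▸ add_pos (mul_pos hθ' hq₀.1) (mul_pos hθ.1 hq₁.1)
  have hG := posSemidef_mul_diagonal_mul S fun k => Real.rpow_nonneg (hd k) θ
  have hB₀ := posSemidef_self_mul_conjTranspose S
  have hB₁ := posSemidef_mul_diagonal_mul S hd
  set V := hG.isHermitian.eigenvectorUnitary with hV
  set X : Matrix ι ι ℂ := (V : Matrix ι ι ℂ)ᴴ * S with hX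
  have hconj (M : Matrix ι ι ℂ) :
      (V : Matrix ι ι ℂ)ᴴ * (S * M * Sᴴ) * (V : Matrix ι ι ℂ) = X * M * Xᴴ := by
    simp [hX, conjTranspose_mul, mul_assoc]
  have hg (l : ι) : hG.isHermitian.eigenvalues l = ∑ k, d k ^ θ * ‖X l k‖ ^ 2 := by
    have h1 : (V : Matrix ι ι ℂ)ᴴ * (S * diagonal (fun k => ((d k ^ θ : ℝ) : ℂ)) * Sᴴ) *
        (V : Matrix ι ι ℂ) = diagonal (fun k => (hG.isHermitian.eigenvalues k : ℂ)) := by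
      have hVV : (V : Matrix ι ι ℂ)ᴴ * (V : Matrix ι ι ℂ) = 1 := Unitary.coe_star_mul_self V
      conv_lhs => rw [hG.isHermitian.eq_mul_diagonal_mul]
      rw [← hV, mul_assoc, mul_assoc, hVV, mul_one, ← mul_assoc, hVV, one_mul]
    have h2 := congrFun (congrFun h1 l) l
    rw [hconj, mul_diagonal_mul_conjTranspose_apply_self, diagonal_apply_eq] at h2
    exact_mod_cast h2.symm
  have hb₀ := sum_diag_rpow_le_trR_mpow hB₀ V (one_le_one_div hq₀.1 hq₀.2)
  have hb₁ := sum_diag_rpow_le_trR_mpow hB₁ V (one_le_one_div hq₁.1 hq₁.2)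
  have hconj₀ : (V : Matrix ι ι ℂ)ᴴ * (S * Sᴴ) * (V : Matrix ι ι ℂ) =
      X * diagonal (fun _ => ((1 : ℝ) : ℂ)) * Xᴴ := by
    rw [← hconj]; simp
  simp only [hconj₀, hconj, mul_diagonal_mul_conjTranspose_apply_self, Complex.ofReal_re,
    one_mul] at hb₀ hb₁
  set b₀ : ι → ℝ := fun l => ∑ k, ‖X l k‖ ^ 2
  set b₁ : ι → ℝ := fun l => ∑ k, d k * ‖X l k‖ ^ 2
  have hb₀0 (l : ι) : 0 ≤ b₀ l := Finset.sum_nonneg fun k _ => by positivity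
  have hb₁0 (l : ι) : 0 ≤ b₁ l := Finset.sum_nonneg fun k _ => mul_nonneg (hd k) (by positivity)
  have hgb (l : ι) : hG.isHermitian.eigenvalues l ≤ b₀ l ^ (1 - θ) * b₁ l ^ θ := by
    rw [hg]
    refine le_trans (le_of_eq ?_) (sum_rpow_mul_rpow_le Finset.univ (fun k _ => by positivity)
      (fun k _ => mul_nonneg (hd k) (by positivity)) hθ' hθ.1 (by ring))
    refine Finset.sum_congr rfl fun k _ => ?_
    rw [Real.mul_rpow (hd k) (by positivity), mul_left_comm,
      ← Real.rpow_add_of_nonneg (by positivity) hθ'.le hθ.1.le]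
    simp
  rw [trR_mpow hG.isHermitian]
  calc ∑ l, hG.isHermitian.eigenvalues l ^ (1 / q)
      ≤ ∑ l, (b₀ l ^ (1 / q₀)) ^ ((1 - θ) * q₀ / q) * (b₁ l ^ (1 / q₁)) ^ (θ * q₁ / q) := by
        refine Finset.sum_le_sum fun l _ => ?_
        refine (Real.rpow_le_rpow (hG.eigenvalues_nonneg l) (hgb l) (by positivity)).trans_eq ?_
        rw [Real.mul_rpow (Real.rpow_nonneg (hb₀0 l) _) (Real.rpow_nonneg (hb₁0 l) _),
          ← Real.rpow_mul (hb₀0 l), ← Real.rpow_mul (hb₁0 l), ← Real.rpow_mul (hb₀0 l),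
          ← Real.rpow_mul (hb₁0 l)]
        have := hq₀.1.ne'
        have := hq₁.1.ne'
        congr 2 <;> field_simp
    _ ≤ (∑ l, b₀ l ^ (1 / q₀)) ^ ((1 - θ) * q₀ / q) * (∑ l, b₁ l ^ (1 / q₁)) ^ (θ * q₁ / q) :=
        sum_rpow_mul_rpow_le Finset.univ (fun l _ => Real.rpow_nonneg (hb₀0 l) _)
          (fun l _ => Real.rpow_nonneg (hb₁0 l) _)
          (div_pos (mul_pos hθ' hq₀.1) hq0) (div_pos (mul_pos hθ.1 hq₁.1) hq0)
          (by rw [← add_div, ← hq, div_self hq0.ne'])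
    _ ≤ _ := by
        have h0 : 0 ≤ ∑ l, b₀ l ^ (1 / q₀) :=
          Finset.sum_nonneg fun l _ => Real.rpow_nonneg (hb₀0 l) _
        have h1 : 0 ≤ ∑ l, b₁ l ^ (1 / q₁) :=
          Finset.sum_nonneg fun l _ => Real.rpow_nonneg (hb₁0 l) _
        exact mul_le_mul
          (Real.rpow_le_rpow h0 hb₀ (div_pos (mul_pos hθ' hq₀.1) hq0).le)
          (Real.rpow_le_rpow h1 hb₁ (div_pos (mul_pos hθ.1 hq₁.1) hq0).le)
          (Real.rpow_nonneg h1 _) (Real.rpow_nonneg (h0.trans hb₀) _)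

theorem mpow_eq {A : Matrix ι ι ℂ} (hA : A.IsHermitian) (r : ℝ) :
    mpow A r = (hA.eigenvectorUnitary : Matrix ι ι ℂ) *
      diagonal (fun k => ((hA.eigenvalues k ^ r : ℝ) : ℂ)) *
      (hA.eigenvectorUnitary : Matrix ι ι ℂ)ᴴ := by
  rw [mpow, hA.cfc_eq, IsHermitian.cfc, Unitary.conjStarAlgAut_apply]
  rfl

theorem posDef_mpow {A : Matrix ι ι ℂ} (hA : A.PosDef) (r : ℝ) : (mpow A r).PosDef := by
  rw [mpow_eq hA.isHermitian, ← star_eq_conjTranspose]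
  exact Unitary.isUnit_coe.posDef_star_right_conjugate_iff.2 <| posDef_diagonal_iff.2 fun k => by
    exact_mod_cast Real.rpow_pos_of_pos (hA.eigenvalues_pos k) r

theorem Matrix.PosDef.pos_of_mem_spectrum {A : Matrix ι ι ℂ} (hA : A.PosDef) {x : ℝ}
    (hx : x ∈ spectrum ℝ A) : 0 < x := by
  rw [hA.isHermitian.spectrum_real_eq_range_eigenvalues] at hx
  obtain ⟨i, rfl⟩ := hx
  exact hA.eigenvalues_pos i

theorem continuousOn_spectrum (A : Matrix ι ι ℂ) (f : ℝ → ℝ) : ContinuousOn f (spectrum ℝ A) :=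
  A.finite_real_spectrum.continuousOn f

theorem mpow_mul_mpow {A : Matrix ι ι ℂ} (hA : A.PosDef) (r s : ℝ) :
    mpow A r * mpow A s = mpow A (r + s) := by
  rw [mpow, mpow, ← cfc_mul _ _ A (continuousOn_spectrum _ _) (continuousOn_spectrum _ _)]
  exact cfc_congr fun x hx => (Real.rpow_add (hA.pos_of_mem_spectrum hx) r s).symm

theorem mpow_mpow {A : Matrix ι ι ℂ} (hA : A.PosDef) (r s : ℝ) :
    mpow (mpow A r) s = mpow A (r * s) := by
  rw [mpow, mpow, ← cfc_comp' _ _ A ((A.finite_real_spectrum.image _).continuousOn _)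
    (continuousOn_spectrum _ _) hA.isHermitian.isSelfAdjoint]
  exact cfc_congr fun x hx => (Real.rpow_mul (hA.pos_of_mem_spectrum hx).le r s).symm

theorem mpow_one {A : Matrix ι ι ℂ} (hA : A.IsHermitian) : mpow A 1 = A := by
  simpa [mpow] using cfc_id' ℝ A hA.isSelfAdjoint

theorem mpow_neg {A : Matrix ι ι ℂ} (hA : A.PosDef) (r : ℝ) : mpow A (-r) = (mpow A r)⁻¹ := by
  refine (inv_eq_right_inv ?_).symm
  rw [mpow_mul_mpow hA, add_neg_cancel, mpow]
  simpa using cfc_const_one ℝ A hA.isHermitian.isSelfAdjoint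

theorem mpow_smul {A : Matrix ι ι ℂ} (hA : A.PosSemidef) {c : ℝ} (hc : 0 ≤ c) (r : ℝ) :
    mpow (c • A) r = c ^ r • mpow A r := by
  rw [mpow, mpow, ← cfc_comp_smul c _ A ((A.finite_real_spectrum.image _).continuousOn _)
    hA.isHermitian.isSelfAdjoint, ← cfc_smul _ _ _ (continuousOn_spectrum _ _)]
  refine cfc_congr fun x hx => ?_
  rw [hA.isHermitian.spectrum_real_eq_range_eigenvalues] at hx
  obtain ⟨i, rfl⟩ := hx
  exact Real.mul_rpow hc (hA.eigenvalues_nonneg i)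

/-- Two positive definite matrices are simultaneously diagonalized by a congruence. -/
theorem exists_congr_diagonal {A B : Matrix ι ι ℂ} (hA : A.PosDef) (hB : B.PosDef) :
    ∃ (S : Matrix ι ι ℂ) (d : ι → ℝ), IsUnit S ∧ (∀ k, 0 < d k) ∧ A = S * Sᴴ ∧
      B = S * diagonal (fun k => (d k : ℂ)) * Sᴴ := by
  set C := mpow A (1 / 2)
  have hCC : C * Cᴴ = A := by
    rw [(posDef_mpow hA _).isHermitian.eq, mpow_mul_mpow hA, add_halves,
      mpow_one hA.isHermitian]
  have hCu : IsUnit C := (posDef_mpow hA _).isUnit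
  have hCd : IsUnit C.det := (isUnit_iff_isUnit_det C).1 hCu
  have hCi : IsUnit C⁻¹ := (isUnit_nonsing_inv_iff).2 hCu
  have hN : (C⁻¹ * B * star C⁻¹).PosDef := hCi.posDef_star_right_conjugate_iff.2 hB
  set U : Matrix ι ι ℂ := ↑hN.isHermitian.eigenvectorUnitary
  refine ⟨C * U, hN.isHermitian.eigenvalues, hCu.mul Unitary.isUnit_coe, hN.eigenvalues_pos,
    ?_, ?_⟩
  · have hUU : U * Uᴴ = 1 := Unitary.coe_mul_star_self _
    rw [conjTranspose_mul, mul_assoc, ← mul_assoc U, hUU, one_mul, hCC]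
  · have hCi' : Cᴴ⁻¹ * Cᴴ = 1 := nonsing_inv_mul _ (by simpa [det_conjTranspose] using hCd)
    calc B = C * (C⁻¹ * B * star C⁻¹) * Cᴴ := by
          rw [star_eq_conjTranspose, conjTranspose_nonsing_inv, mul_assoc, mul_assoc, hCi',
            mul_one, mul_nonsing_inv_cancel_left _ _ hCd]
      _ = C * (U * diagonal (fun k => (hN.isHermitian.eigenvalues k : ℂ)) * Uᴴ) * Cᴴ :=
          congrArg (fun X => C * X * Cᴴ) hN.isHermitian.eq_mul_diagonal_mul
      _ = _ := by simp only [conjTranspose_mul, mul_assoc]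

/-- The trace functional `Tr (σ ^ (s / 2) W σ ^ (s / 2)) ^ (1 / (1 + s))`, which is the sandwiched
Rényi trace functional of order `1 / (1 + s)`. -/
noncomputable def sandwichedTrace (s : ℝ) (σ W : Matrix ι ι ℂ) : ℝ :=
  trR (mpow (mpow σ (s / 2) * W * mpow σ (s / 2)) (1 / (1 + s)))

theorem sandwichedTrace_eq {σ : Matrix ι ι ℂ} (hσ : σ.PosDef) (s : ℝ) (C : Matrix ι ι ℂ) :
    sandwichedTrace s σ (C * Cᴴ) = trR (mpow (Cᴴ * mpow σ s * C) (1 / (1 + s))) := by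
  have h := (posDef_mpow hσ (s / 2)).isHermitian
  refine trR_mpow_congr ?_ ((posDef_mpow hσ s).posSemidef.conjTranspose_mul_mul_same C).1 ?_ _
  · have := (posSemidef_self_mul_conjTranspose C).mul_mul_conjTranspose_same (mpow σ (s / 2))
    rw [h.eq] at this
    exact this.1
  · rw [charpoly_mul_comm, ← mul_assoc, mpow_mul_mpow hσ, add_halves, ← mul_assoc,
      charpoly_mul_comm, ← mul_assoc]

theorem one_le_sandwichedTrace {σ W : Matrix ι ι ℂ} (hσ : σ.PosDef) (hσ1 : σ.trace = 1)
    (hW : W.PosSemidef) (hW1 : W.trace = 1) {s : ℝ} (hs : s ∈ Set.Ioo (-1 : ℝ) 0) :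
    1 ≤ sandwichedTrace s σ W := by
  have hs0 : 0 < -s := neg_pos.2 hs.2
  have hs1 : 0 < 1 + s := by linarith [hs.1]
  set V := hσ.isHermitian.eigenvectorUnitary with hV
  set l := hσ.isHermitian.eigenvalues with hl
  have hlpos : ∀ k, 0 < l k := hσ.eigenvalues_pos
  have hVV : (V : Matrix ι ι ℂ)ᴴ * (V : Matrix ι ι ℂ) = 1 := Unitary.coe_star_mul_self V
  set N := (V : Matrix ι ι ℂ)ᴴ * W * (V : Matrix ι ι ℂ) with hN
  have hNp : N.PosSemidef := hW.conjTranspose_mul_mul_same _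
  have hsum : ∑ k, (N k k).re = 1 := by
    have : N.trace = 1 := by
      have hVV' : (V : Matrix ι ι ℂ) * (V : Matrix ι ι ℂ)ᴴ = 1 := Unitary.coe_mul_star_self V
      rw [hN, trace_mul_cycle, hVV', one_mul, hW1]
    simpa [trace] using congrArg Complex.re this
  have hlsum : ∑ k, l k = 1 := by
    have := hσ.isHermitian.trace_eq_sum_eigenvalues
    rw [hσ1] at this
    simpa using (congrArg Complex.re this).symm
  have hY : (mpow σ (s / 2) * W * mpow σ (s / 2)).PosSemidef := by
    have := hW.mul_mul_conjTranspose_same (mpow σ (s / 2))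
    rwa [(posDef_mpow hσ (s / 2)).isHermitian.eq] at this
  have hdiag (k : ι) : (((V : Matrix ι ι ℂ)ᴴ * (mpow σ (s / 2) * W * mpow σ (s / 2)) *
      (V : Matrix ι ι ℂ)) k k).re = l k ^ s * (N k k).re := by
    have : (V : Matrix ι ι ℂ)ᴴ * (mpow σ (s / 2) * W * mpow σ (s / 2)) * (V : Matrix ι ι ℂ) =
        diagonal (fun k => ((l k ^ (s / 2) : ℝ) : ℂ)) * N *
          diagonal (fun k => ((l k ^ (s / 2) : ℝ) : ℂ)) := by
      simp only [mpow_eq hσ.isHermitian, ← hV, ← hl, hN, mul_assoc, hVV, mul_one]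
      rw [← mul_assoc (V : Matrix ι ι ℂ)ᴴ, hVV, one_mul]
    rw [this, mul_diagonal, diagonal_mul, mul_right_comm, ← Complex.ofReal_mul,
      Complex.re_ofReal_mul, ← Real.rpow_add (hlpos k), add_halves]
  have hP := sum_diag_rpow_le_trR_mpow hY V (one_le_one_div hs1 (by linarith [hs.2]))
  simp only [hdiag] at hP
  have hYoung (k : ι) : (N k k).re ≤
      -s * l k + (1 + s) * (l k ^ s * (N k k).re) ^ (1 / (1 + s)) := by
    have hNk : 0 ≤ (N k k).re := (Complex.nonneg_iff.1 (hNp.diag_nonneg (i := k))).1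
    have hk : 0 ≤ l k ^ s * (N k k).re := mul_nonneg (Real.rpow_nonneg (hlpos k).le _) hNk
    have := Real.geom_mean_le_arith_mean2_weighted hs0.le hs1.le (hlpos k).le
      (Real.rpow_nonneg hk (1 / (1 + s))) (by ring)
    rwa [← Real.rpow_mul hk, one_div_mul_cancel hs1.ne', Real.rpow_one, ← mul_assoc,
      ← Real.rpow_add (hlpos k), neg_add_cancel, Real.rpow_zero, one_mul] at this
  have := Finset.sum_le_sum fun k (_ : k ∈ Finset.univ) => hYoung k
  rw [hsum, Finset.sum_add_distrib, ← Finset.mul_sum, ← Finset.mul_sum, hlsum] at this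
  have h2 := mul_le_mul_of_nonneg_left hP hs1.le
  refine le_of_mul_le_mul_left ?_ hs1
  change (1 + s) * 1 ≤ (1 + s) * trR _
  linarith

/-- Interpolation of the sandwiched trace functional in `(s, σ)`, uniformly in `W`. -/
theorem exists_sandwichedTrace_le {σ₀ σ₁ : Matrix ι ι ℂ} [Nonempty ι]
    (hσ₀ : σ₀.PosDef ∧ σ₀.trace = 1) (hσ₁ : σ₁.PosDef ∧ σ₁.trace = 1) {s₀ s₁ s θ : ℝ}
    (hs₀ : s₀ ∈ Set.Ioo (-1 : ℝ) 0) (hs₁ : s₁ ∈ Set.Ioo (-1 : ℝ) 0)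
    (hθ : θ ∈ Set.Ioo (0 : ℝ) 1) (hs : s = (1 - θ) * s₀ + θ * s₁) :
    ∃ σ : Matrix ι ι ℂ, (σ.PosDef ∧ σ.trace = 1) ∧ ∀ W : Matrix ι ι ℂ, W.PosDef →
      sandwichedTrace s σ W ≤
        sandwichedTrace s₀ σ₀ W ^ ((1 - θ) * (1 + s₀) / (1 + s)) *
          sandwichedTrace s₁ σ₁ W ^ (θ * (1 + s₁) / (1 + s)) := by
  have hθ' : 0 < 1 - θ := sub_pos.2 hθ.2
  have hsneg : 0 < -s := by
    have := add_pos (mul_pos hθ' (neg_pos.2 hs₀.2)) (mul_pos hθ.1 (neg_pos.2 hs₁.2))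
    linarith
  have hs1 : 0 < 1 + s := by
    have := add_pos (mul_pos hθ' (neg_lt_iff_pos_add'.1 hs₀.1))
      (mul_pos hθ.1 (neg_lt_iff_pos_add'.1 hs₁.1))
    linarith
  obtain ⟨S, d, hS, hd, hM₀, hM₁⟩ :=
    exists_congr_diagonal (posDef_mpow hσ₀.1 s₀) (posDef_mpow hσ₁.1 s₁)
  have hSd : IsUnit S.det := (isUnit_iff_isUnit_det S).1 hS
  have hSSi : S * S⁻¹ = 1 := mul_nonsing_inv S hSd
  have hinv {e f : ι → ℝ} (hef : ∀ k, e k * f k = 1) :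
      (S * diagonal (fun k => (e k : ℂ)) * Sᴴ)⁻¹ =
        (S⁻¹)ᴴ * diagonal (fun k => (f k : ℂ)) * (S⁻¹)ᴴᴴ := by
    refine inv_eq_right_inv ?_
    rw [conjTranspose_conjTranspose]
    calc _ = S * (diagonal (fun k => (e k : ℂ)) * (Sᴴ * (S⁻¹)ᴴ) *
            diagonal (fun k => (f k : ℂ))) * S⁻¹ := by simp only [mul_assoc]
      _ = 1 := by
        rw [← conjTranspose_mul, nonsing_inv_mul S hSd, conjTranspose_one, mul_one,
          diagonal_mul_diagonal]
        simp only [← Complex.ofReal_mul, hef, Complex.ofReal_one, diagonal_one, mul_one, hSSi]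
  set M := S * diagonal (fun k => ((d k ^ θ : ℝ) : ℂ)) * Sᴴ with hM
  have hMp : M.PosDef := by
    rw [hM, ← star_eq_conjTranspose]
    exact hS.posDef_star_right_conjugate_iff.2 <| posDef_diagonal_iff.2 fun k => by
      exact_mod_cast Real.rpow_pos_of_pos (hd k) θ
  have hMinv : M⁻¹ = (S⁻¹)ᴴ * diagonal (fun k => (((d k)⁻¹ ^ θ : ℝ) : ℂ)) * (S⁻¹)ᴴᴴ :=
    hinv fun k => by
      rw [← Real.mul_rpow (hd k).le (inv_pos.2 (hd k)).le, mul_inv_cancel₀ (hd k).ne',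
        Real.one_rpow]
  have hM₀inv : (S⁻¹)ᴴ * (S⁻¹)ᴴᴴ = mpow σ₀ (-s₀) := by
    rw [mpow_neg hσ₀.1, hM₀]
    simpa using (hinv (e := fun _ => 1) (f := fun _ => 1) (by simp)).symm
  have hM₁inv : (S⁻¹)ᴴ * diagonal (fun k => (((d k)⁻¹ : ℝ) : ℂ)) * (S⁻¹)ᴴᴴ = mpow σ₁ (-s₁) := by
    rw [mpow_neg hσ₁.1, hM₁, hinv fun k => mul_inv_cancel₀ (hd k).ne']
  have htr {σ : Matrix ι ι ℂ} (hσ : σ.PosDef ∧ σ.trace = 1) {r : ℝ} (hr : r < 0) :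
      trR (mpow (mpow σ (-r)) (1 / -r)) = 1 := by
    rw [mpow_mpow hσ.1, mul_one_div_cancel (neg_pos.2 hr).ne', mpow_one hσ.1.isHermitian, trR,
      hσ.2, Complex.one_re]
  set c := trR (mpow M⁻¹ (1 / -s)) with hc
  have hτ := posDef_mpow hMp.inv (1 / -s)
  have hctr : (mpow M⁻¹ (1 / -s)).trace = (c : ℂ) :=
    (Complex.eq_re_of_ofReal_le (r := 0) (by simpa using hτ.posSemidef.trace_nonneg))
  have hc0 : 0 < c := by
    have := hτ.trace_pos
    rw [hctr] at this
    exact_mod_cast this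
  have hc1 : c ≤ 1 := by
    have h := trR_mpow_geomMean_le (S⁻¹)ᴴ (fun k => (inv_pos.2 (hd k)).le) hθ
      (q₀ := -s₀) (q₁ := -s₁) (q := -s) ⟨neg_pos.2 hs₀.2, by linarith [hs₀.1]⟩
      ⟨neg_pos.2 hs₁.2, by linarith [hs₁.1]⟩ (by rw [hs]; ring)
    rw [← hMinv, hM₀inv, hM₁inv, htr hσ₀ hs₀.2, htr hσ₁ hs₁.2] at h
    rwa [Real.one_rpow, Real.one_rpow, mul_one] at h
  have hσs : mpow (c⁻¹ • mpow M⁻¹ (1 / -s)) s = c ^ (-s) • M := by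
    have hs' : (1 / -s) * s = -1 := by
      have : s ≠ 0 := by linarith
      field_simp
    rw [mpow_smul hτ.posSemidef (inv_pos.2 hc0).le, mpow_mpow hMp.inv, hs', mpow_neg hMp.inv,
      mpow_one hMp.inv.isHermitian, nonsing_inv_nonsing_inv _
      ((isUnit_iff_isUnit_det M).1 hMp.isUnit), Real.inv_rpow hc0.le, Real.rpow_neg hc0.le]
  have hσp : (c⁻¹ • mpow M⁻¹ (1 / -s)).PosDef := hτ.smul (inv_pos.2 hc0)
  refine ⟨c⁻¹ • mpow M⁻¹ (1 / -s), ⟨hσp, ?_⟩, fun W hW => ?_⟩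
  · rw [trace_smul, hctr, Complex.real_smul, ← Complex.ofReal_mul, inv_mul_cancel₀ hc0.ne',
      Complex.ofReal_one]
  · obtain ⟨C, -, -, -, rfl, -⟩ := exists_congr_diagonal hW hW
    have hT := trR_mpow_geomMean_le (Cᴴ * S) (fun k => (hd k).le) hθ
      (q₀ := 1 + s₀) (q₁ := 1 + s₁) (q := 1 + s) ⟨by linarith [hs₀.1], by linarith [hs₀.2]⟩
      ⟨by linarith [hs₁.1], by linarith [hs₁.2]⟩ (by rw [hs]; ring)
    have hassoc (D : Matrix ι ι ℂ) : Cᴴ * S * D * (Cᴴ * S)ᴴ = Cᴴ * (S * D * Sᴴ) * C := by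
      simp [conjTranspose_mul, mul_assoc]
    have hassoc₀ : Cᴴ * S * (Cᴴ * S)ᴴ = Cᴴ * (S * Sᴴ) * C := by
      simp [conjTranspose_mul, mul_assoc]
    rw [hassoc, hassoc, hassoc₀, ← hM, ← hM₀, ← hM₁, ← sandwichedTrace_eq hσ₀.1,
      ← sandwichedTrace_eq hσ₁.1] at hT
    refine le_trans ?_ hT
    have hCM := hMp.posSemidef.conjTranspose_mul_mul_same C
    rw [sandwichedTrace_eq hσp, hσs, Matrix.mul_smul, Matrix.smul_mul,
      mpow_smul hCM (by positivity), trR_smul]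
    refine mul_le_of_le_one_left (trR_mpow_nonneg hCM _) ?_
    exact Real.rpow_le_one (by positivity) (Real.rpow_le_one hc0.le hc1 hsneg.le) (by positivity)

end Matrices

theorem sandwichedRenyiInfo_one_div {d n : ℕ} {s : ℝ} (hs : s ∈ Set.Ioo (-1 : ℝ) 0)
    (W : Fin n → Matrix (Fin d) (Fin d) ℂ) (P : Fin n → ℝ) :
    sandwichedRenyiInfo (1 / (1 + s)) W P =
      ⨅ σ : Dens d, (1 + s) / (-s) * Real.log (∑ i, P i * sandwichedTrace s σ.1 (W i)) := by
  have h1 : 1 + s ≠ 0 := by linarith [hs.1]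
  have h0 : s ≠ 0 := hs.2.ne
  have e1 : (1 - 1 / (1 + s)) / (2 * (1 / (1 + s))) = s / 2 := by
    field_simp
    ring
  have e2 : 1 / (1 / (1 + s) - 1) = (1 + s) / (-s) := by
    rw [div_sub_one h1, one_div_div]
    congr 1
    ring
  rw [sandwichedRenyiInfo, e1, e2]
  rfl

theorem one_le_sum_mul_of_mem_stdSimplex {ι : Type*} [Fintype ι] {P q : ι → ℝ}
    (hP : P ∈ stdSimplex ℝ ι) (hq : ∀ i, 1 ≤ q i) : 1 ≤ ∑ i, P i * q i := by
  rw [← hP.2]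
  exact Finset.sum_le_sum fun i _ => le_mul_of_one_le_right (hP.1 i) (hq i)

theorem concaveOn_log_sum {ι : Type*} [Fintype ι] {q : ι → ℝ} (hq : ∀ i, 1 ≤ q i) :
    ConcaveOn ℝ (stdSimplex ℝ ι) fun P => Real.log (∑ i, P i * q i) := by
  have h := strictConcaveOn_log_Ioi.concaveOn.comp_linearMap
    (∑ i, q i • LinearMap.proj i : (ι → ℝ) →ₗ[ℝ] ℝ)
  refine (h.subset (fun P hP => ?_) (convex_stdSimplex ℝ ι)).congr fun P _ => ?_
  · have := one_le_sum_mul_of_mem_stdSimplex hP hq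
    simpa [mul_comm] using zero_lt_one.trans_le this
  · simp [mul_comm]

theorem continuousOn_log_sum {ι : Type*} [Fintype ι] {q : ι → ℝ} (hq : ∀ i, 1 ≤ q i) :
    ContinuousOn (fun P : ι → ℝ => Real.log (∑ i, P i * q i)) (stdSimplex ℝ ι) :=
  ContinuousOn.log (by fun_prop) fun _ hP =>
    (zero_lt_one.trans_le (one_le_sum_mul_of_mem_stdSimplex hP hq)).ne'

/-- The functional `(s, σ) ↦ (1 + s) log ∑ P(i) sandwichedTrace s σ W_i` is convex-like,
uniformly in `P`. -/
theorem exists_mul_log_sum_sandwichedTrace_le {d n : ℕ} [NeZero d]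
    {W : Fin n → Matrix (Fin d) (Fin d) ℂ} (hW : ∀ i, (W i).PosDef ∧ (W i).trace = 1)
    {s₀ s₁ s θ : ℝ} (σ₀ σ₁ : Dens d)
    (hs₀ : s₀ ∈ Set.Ioo (-1 : ℝ) 0) (hs₁ : s₁ ∈ Set.Ioo (-1 : ℝ) 0) (hs' : s ∈ Set.Ioo (-1 : ℝ) 0)
    (hθ : θ ∈ Set.Ioo (0 : ℝ) 1) (hs : s = (1 - θ) * s₀ + θ * s₁) :
    ∃ σ : Dens d, ∀ P ∈ stdSimplex ℝ (Fin n),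
      (1 + s) * Real.log (∑ i, P i * sandwichedTrace s σ.1 (W i)) ≤
        (1 - θ) * ((1 + s₀) * Real.log (∑ i, P i * sandwichedTrace s₀ σ₀.1 (W i))) +
          θ * ((1 + s₁) * Real.log (∑ i, P i * sandwichedTrace s₁ σ₁.1 (W i))) := by
  have hone {s : ℝ} (hs : s ∈ Set.Ioo (-1 : ℝ) 0) (σ : Dens d) (i : Fin n) :
      1 ≤ sandwichedTrace s σ.1 (W i) :=
    one_le_sandwichedTrace σ.2.1 σ.2.2 (hW i).1.posSemidef (hW i).2 hs
  obtain ⟨σ, hσ, hle⟩ := exists_sandwichedTrace_le σ₀.2 σ₁.2 hs₀ hs₁ hθ hs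
  refine ⟨⟨σ, hσ⟩, fun P hP => ?_⟩
  have hp {s : ℝ} (hs : s ∈ Set.Ioo (-1 : ℝ) 0) (σ : Dens d) :
      0 < ∑ i, P i * sandwichedTrace s σ.1 (W i) :=
    zero_lt_one.trans_le (one_le_sum_mul_of_mem_stdSimplex hP (hone hs σ))
  have h1 : 0 < 1 + s := by linarith [hs'.1]
  have hw₀ : 0 < (1 - θ) * (1 + s₀) / (1 + s) :=
    div_pos (mul_pos (sub_pos.2 hθ.2) (by linarith [hs₀.1])) h1
  have hw₁ : 0 < θ * (1 + s₁) / (1 + s) := div_pos (mul_pos hθ.1 (by linarith [hs₁.1])) h1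
  have hw : (1 - θ) * (1 + s₀) / (1 + s) + θ * (1 + s₁) / (1 + s) = 1 := by
    rw [← add_div, div_eq_one_iff_eq h1.ne', hs]
    ring
  have hsum : ∑ i, P i * sandwichedTrace s σ (W i) ≤
      (∑ i, P i * sandwichedTrace s₀ σ₀.1 (W i)) ^ ((1 - θ) * (1 + s₀) / (1 + s)) *
        (∑ i, P i * sandwichedTrace s₁ σ₁.1 (W i)) ^ (θ * (1 + s₁) / (1 + s)) := by
    have h0 {s : ℝ} (hs : s ∈ Set.Ioo (-1 : ℝ) 0) (σ : Dens d) (i : Fin n) :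
        0 ≤ sandwichedTrace s σ.1 (W i) := zero_le_one.trans (hone hs σ i)
    refine le_trans (Finset.sum_le_sum fun i _ => ?_) (sum_rpow_mul_rpow_le Finset.univ
      (fun i _ => mul_nonneg (hP.1 i) (h0 hs₀ σ₀ i))
      (fun i _ => mul_nonneg (hP.1 i) (h0 hs₁ σ₁ i)) hw₀ hw₁ hw)
    rw [Real.mul_rpow (hP.1 i) (h0 hs₀ σ₀ i), Real.mul_rpow (hP.1 i) (h0 hs₁ σ₁ i),
      mul_mul_mul_comm, ← Real.rpow_add_of_nonneg (hP.1 i) hw₀.le hw₁.le, hw, Real.rpow_one]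
    exact mul_le_mul_of_nonneg_left (hle _ (hW i).1) (hP.1 i)
  have hlog := Real.log_le_log (hp hs' ⟨σ, hσ⟩) hsum
  rw [Real.log_mul (Real.rpow_pos_of_pos (hp hs₀ σ₀) _).ne'
    (Real.rpow_pos_of_pos (hp hs₁ σ₁) _).ne', Real.log_rpow (hp hs₀ σ₀),
    Real.log_rpow (hp hs₁ σ₁)] at hlog
  refine (mul_le_mul_of_nonneg_left hlog h1.le).trans_eq ?_
  field_simp

/-- minimax identity for the strong converse exponent. -/
theorem strong_converse_minimax {d n : ℕ} (hd : 0 < d) (hn : 0 < n)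
    (W : Fin n → Matrix (Fin d) (Fin d) ℂ)
    (hW : ∀ i, (W i).PosDef ∧ (W i).trace = 1)
    (R : ℝ) :
    (⨅ P : {P : Fin n → ℝ // (∀ i, 0 ≤ P i) ∧ ∑ i, P i = 1},
      ⨆ s : Set.Ioo (-1 : ℝ) 0,
        (s.1 * sandwichedRenyiInfo (1 / (1 + s.1)) W P.1 - s.1 * R)) =
    ⨆ s : Set.Ioo (-1 : ℝ) 0,
      ⨅ P : {P : Fin n → ℝ // (∀ i, 0 ≤ P i) ∧ ∑ i, P i = 1},
        (s.1 * sandwichedRenyiInfo (1 / (1 + s.1)) W P.1 - s.1 * R) := by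
  have : NeZero d := ⟨hd.ne'⟩
  have : NeZero n := ⟨hn.ne'⟩
  let Prob := {P : Fin n → ℝ // (∀ i, 0 ≤ P i) ∧ ∑ i, P i = 1}
  let F (s : Set.Ioo (-1 : ℝ) 0) (P : Prob) : ℝ :=
    s.1 * sandwichedRenyiInfo (1 / (1 + s.1)) W P.1 - s.1 * R
  change (⨅ P, ⨆ s, F s P) = ⨆ s, ⨅ P, F s P
  have : Nonempty Prob := ⟨⟨_, single_mem_stdSimplex ℝ (0 : Fin n)⟩⟩
  have : Nonempty (Set.Ioo (-1 : ℝ) 0) := ⟨⟨-1 / 2, by norm_num, by norm_num⟩⟩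
  have : Nonempty (Dens d) := by
    refine ⟨⟨(d : ℝ)⁻¹ • 1, PosDef.one.smul (by positivity), ?_⟩⟩
    have : (d : ℂ) ≠ 0 := by exact_mod_cast hd.ne'
    simp [trace_smul, this]
  let q (j : Set.Ioo (-1 : ℝ) 0 × Dens d) (i : Fin n) : ℝ := sandwichedTrace j.1.1 j.2.1 (W i)
  have hq j i : 1 ≤ q j i :=
    one_le_sandwichedTrace j.2.2.1 j.2.2.2 (hW i).1.posSemidef (hW i).2 j.1.2
  let G (j : Set.Ioo (-1 : ℝ) 0 × Dens d) (P : Fin n → ℝ) : ℝ :=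
    -((1 + j.1.1) * Real.log (∑ i, P i * q j i)) - j.1.1 * R
  have hF (s : Set.Ioo (-1 : ℝ) 0) (P : Prob) :
      F s P = s.1 * (⨅ σ, (1 + s.1) / (-s.1) * Real.log (∑ i, P.1 i * q (s, σ) i)) - s.1 * R := by
    simp only [F, sandwichedRenyiInfo_one_div s.2, q]
  have hG (s : Set.Ioo (-1 : ℝ) 0) (σ : Dens d) (P : Fin n → ℝ) :
      G (s, σ) P = s.1 * ((1 + s.1) / (-s.1) * Real.log (∑ i, P i * q (s, σ) i)) - s.1 * R := by
    have : s.1 ≠ 0 := s.2.2.ne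
    simp only [G]
    field_simp
  have hterm (s : Set.Ioo (-1 : ℝ) 0) (P : Prob) (σ : Dens d) :
      0 ≤ (1 + s.1) / (-s.1) * Real.log (∑ i, P.1 i * q (s, σ) i) :=
    mul_nonneg (div_nonneg (by linarith [s.2.1]) (by linarith [s.2.2]))
      (Real.log_nonneg (one_le_sum_mul_of_mem_stdSimplex P.2 (hq _)))
  have hGF s σ (P : Prob) : G (s, σ) P.1 ≤ F s P := by
    rw [hF, hG]
    exact sub_le_sub_right (mul_le_mul_of_nonpos_left
      (ciInf_le ⟨0, Set.forall_mem_range.2 (hterm s P)⟩ σ) s.2.2.le) _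
  have hFG {c s} {P : Prob} (h : c < F s P) : ∃ σ, c < G (s, σ) P.1 := by
    have hs : 0 < -s.1 := neg_pos.2 s.2.2
    rw [hF] at h
    obtain ⟨σ, hσ⟩ := exists_lt_of_ciInf_lt
      (f := fun σ => (1 + s.1) / (-s.1) * Real.log (∑ i, P.1 i * q (s, σ) i))
      (a := (c + s.1 * R) / s.1) (by
        rw [lt_div_iff_of_neg s.2.2]
        linarith)
    refine ⟨σ, ?_⟩
    rw [lt_div_iff_of_neg s.2.2] at hσ
    rw [hG]
    linarith
  have hFle s P : F s P ≤ |R| := by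
    have h1 := mul_nonneg (neg_nonneg.2 s.2.2.le) (Real.iInf_nonneg (hterm s P))
    have h2 : -s.1 * R ≤ |R| :=
      (mul_le_mul_of_nonneg_left (le_abs_self R) (neg_nonneg.2 s.2.2.le)).trans
        (mul_le_of_le_one_left (abs_nonneg R) (by linarith [s.2.1]))
    rw [hF]
    linarith
  have hbelow s : BddBelow (Set.range (F s)) := by
    obtain ⟨σ⟩ := ‹Nonempty (Dens d)›
    obtain ⟨b, hb⟩ := (isCompact_stdSimplex ℝ (Fin n)).bddBelow_image
      (f := G (s, σ)) (((continuousOn_log_sum (hq _)).const_mul _).neg.sub continuousOn_const)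
    exact ⟨b, Set.forall_mem_range.2 fun P =>
      (hb (Set.mem_image_of_mem _ P.2)).trans (hGF s σ P)⟩
  have habove P : BddAbove (Set.range fun s => F s P) :=
    ⟨|R|, Set.forall_mem_range.2 fun s => hFle s P⟩
  obtain ⟨s₀⟩ := ‹Nonempty (Set.Ioo (-1 : ℝ) 0)›
  obtain ⟨P₀⟩ := ‹Nonempty Prob›
  have hbelow' : BddBelow (Set.range fun P => ⨆ s, F s P) := by
    obtain ⟨b, hb⟩ := hbelow s₀
    exact ⟨b, Set.forall_mem_range.2 fun P =>
      (hb ⟨P, rfl⟩).trans (le_ciSup (habove P) s₀)⟩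
  have habove' : BddAbove (Set.range fun s => ⨅ P, F s P) :=
    ⟨|R|, Set.forall_mem_range.2 fun s => (ciInf_le (hbelow s) P₀).trans (hFle s P₀)⟩
  refine le_antisymm (le_of_forall_lt fun c hc => ?_)
    (ciSup_le fun s => le_ciInf fun P => (ciInf_le (hbelow s) P).trans (le_ciSup (habove P) s))
  obtain ⟨c', hcc', hc'⟩ := exists_between hc
  obtain ⟨⟨s, σ⟩, h⟩ := exists_forall_gt_of_concaveLike (G := G) (c := c')
    (isCompact_stdSimplex ℝ (Fin n)) (convex_stdSimplex ℝ (Fin n))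
    (fun j => (((concaveOn_log_sum (hq j)).smul (by linarith [j.1.2.1] : 0 ≤ 1 + j.1.1)).neg.sub
      (concaveOn_const _ (convex_stdSimplex ℝ (Fin n)))))
    (fun j => ((continuousOn_log_sum (hq j)).const_mul _).neg.sub continuousOn_const)
    (fun ⟨s₀, σ₀⟩ ⟨s₁, σ₁⟩ θ hθ => by
      have hs := convex_Ioo (-1 : ℝ) 0 s₀.2 s₁.2 (sub_nonneg.2 hθ.2.le) hθ.1.le
        (sub_add_cancel 1 θ)
      obtain ⟨σ, hσ⟩ := exists_mul_log_sum_sandwichedTrace_le hW σ₀ σ₁ s₀.2 s₁.2 hs hθ rfl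
      refine ⟨(⟨_, hs⟩, σ), fun P hP => ?_⟩
      have := hσ P hP
      simp only [G, q, smul_eq_mul] at this ⊢
      linarith)
    (fun P hP => by
      obtain ⟨s, hs⟩ := exists_lt_of_lt_ciSup
        (hc'.trans_le (ciInf_le hbelow' (⟨P, hP⟩ : Prob)))
      obtain ⟨σ, hσ⟩ := hFG hs
      exact ⟨(s, σ), hσ⟩)
  exact hcc'.trans_le <| le_trans (le_ciInf fun P => (h P.1 P.2).le.trans (hGF s σ P))
    (le_ciSup habove' s)
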